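/- Let μ and ν be Borel probability measures on ℝ^d with μ absolutely continuous with respect to the Lebesgue measure L^d, let D ⊆ ℝ^d be a compact convex set with 0 in its interior, and assume there exists at least one coupling π₀ ∈ Π(μ,ν) with ∫ ‖y − x‖_{D*} dπ₀(x,y) < ∞. Then there exists a Borel map T : ℝ^d → ℝ^d with T_#μ = ν such that ∫ ‖T(x) − x‖_{D*} dμ(x) = min_{π ∈ Π(μ,ν)} ∫ ‖y − x‖_{D*} dπ(x,y); in particular T is an optimal transport map for the Monge problem with convex norm cost ‖·‖_{D*}. -/

import Mathlib

open MeasureTheory Set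
open scoped ENNReal

noncomputable section

abbrev Euc (d : ℕ) : Type := EuclideanSpace ℝ (Fin d)

/-- `π` is a coupling (transference plan) between `μ` and `ν`. -/
def IsCoupling {X : Type*} [MeasurableSpace X] (π : Measure (X × X)) (μ ν : Measure X) : Prop :=
  π.map Prod.fst = μ ∧ π.map Prod.snd = ν

/-- The transport cost `c(x,y) = ‖y - x‖_{D*}` given by the Minkowski gauge of `D`. -/
def normCost {d : ℕ} (D : Set (Euc d)) (p : Euc d × Euc d) : ℝ≥0∞ :=
  ENNReal.ofReal (gauge D (p.2 - p.1))

open ProbabilityTheory in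
lemma glue {Z W : Type*} [MeasurableSpace Z] [StandardBorelSpace Z] [Nonempty Z]
    [MeasurableSpace W] [StandardBorelSpace W]
    (α β : Measure Z) [IsFiniteMeasure α] [IsFiniteMeasure β] (F G : Z → W)
    (hF : Measurable F) (hG : Measurable G) (hns : ¬ (α.map F ⟂ₘ β.map G)) :
    ∃ κ : Measure (Z × Z), κ ≠ 0 ∧ κ.map Prod.fst ≤ α ∧ κ.map Prod.snd ≤ β ∧
      ∀ᵐ z ∂κ, F z.1 = G z.2 := by
  classical
  rw [Measure.mutuallySingular_iff_disjoint, disjoint_iff] at hns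
  set σ : Measure W := α.map F ⊓ β.map G with hσ
  have h1 : σ ≤ α.map F := inf_le_left
  have h2 : σ ≤ β.map G := inf_le_right
  have : IsFiniteMeasure σ := ⟨(h1 univ).trans_lt (measure_lt_top _ _)⟩
  let a : Kernel W Z := condDistrib id F α
  let b : Kernel W Z := condDistrib id G β
  have key : ∀ (γ : Measure Z) [IsFiniteMeasure γ] (H : Z → W), Measurable H → σ ≤ γ.map H →
      σ.bind (condDistrib id H γ) ≤ γ ∧ ∀ᵐ x ∂σ, ∀ᵐ z ∂(condDistrib id H γ x), H z = x := by
    intro γ _ H hH hle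
    constructor
    · have := condDistrib_comp_map (X := H) (Y := id) (μ := γ) hH.aemeasurable aemeasurable_id
      rw [Measure.map_id] at this
      conv_rhs => rw [← this]
      refine Measure.le_iff.2 fun s hs => ?_
      rw [Measure.bind_apply hs (Kernel.aemeasurable _), Measure.bind_apply hs (Kernel.aemeasurable _)]
      exact lintegral_mono' hle le_rfl
    · have hh : ∀ᵐ p ∂((γ.map H) ⊗ₘ condDistrib id H γ), H p.2 = p.1 := by
        rw [compProd_map_condDistrib aemeasurable_id,
          ae_map_iff (by fun_prop) (measurableSet_eq_fun (by fun_prop) (by fun_prop))]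
        simp
      exact (Measure.absolutelyContinuous_of_le hle).ae_le (Measure.ae_ae_of_ae_compProd hh)
  obtain ⟨ha1, ha2⟩ := key α F hF h1
  obtain ⟨hb1, hb2⟩ := key β G hG h2
  refine ⟨σ.bind (a ×ₖ b), ?_, ?_, ?_, ?_⟩
  · intro h0
    have := congrArg (fun m => m univ) h0
    simp only [Measure.coe_zero, Pi.zero_apply] at this
    rw [Measure.bind_apply MeasurableSet.univ (Kernel.aemeasurable _)] at this
    simp at this
    exact hns (le_bot_iff.1 (this ▸ Measure.zero_le _))
  · refine le_trans (le_of_eq ?_) ha1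
    rw [Measure.map_comp _ _ measurable_fst, ← Kernel.fst_eq, Kernel.fst_prod]
  · refine le_trans (le_of_eq ?_) hb1
    rw [Measure.map_comp _ _ measurable_snd, ← Kernel.snd_eq, Kernel.snd_prod]
  · rw [ae_iff]
    have hm : MeasurableSet {z : Z × Z | ¬ F z.1 = G z.2} :=
      (measurableSet_eq_fun (by fun_prop) (by fun_prop)).compl
    rw [Measure.bind_apply hm (Kernel.aemeasurable _)]
    rw [lintegral_eq_zero_iff (Kernel.measurable_coe _ hm)]
    filter_upwards [ha2, hb2] with x hx hy
    simp only [Pi.zero_apply]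
    rw [Kernel.prod_apply, ← ae_iff]
    have e1 : ∀ᵐ z ∂((a x).prod (b x)), F z.1 = x :=
      Measure.quasiMeasurePreserving_fst.ae hx
    have e2 : ∀ᵐ z ∂((a x).prod (b x)), G z.2 = x :=
      Measure.quasiMeasurePreserving_snd.ae hy
    filter_upwards [e1, e2] with z h1 h2
    rw [h1, h2]

lemma swap_exists {X : Type*} [MeasurableSpace X] (π : Measure (X × X)) [IsFiniteMeasure π]
    (κ : Measure ((X × X) × (X × X))) (h1 : κ.map Prod.fst ≤ π) (h2 : κ.map Prod.snd ≤ π) :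
    ∃ π' : Measure (X × X), π'.map Prod.fst = π.map Prod.fst ∧ π'.map Prod.snd = π.map Prod.snd ∧
      ∀ c : X × X → ℝ≥0∞, Measurable c →
        ∫⁻ p, c p ∂π' + 2⁻¹ * ∫⁻ z, (c z.1 + c z.2) ∂κ =
        ∫⁻ p, c p ∂π + 2⁻¹ * ∫⁻ z, (c (z.1.1, z.2.2) + c (z.2.1, z.1.2)) ∂κ := by
  set s : Measure (X × X) := (2⁻¹ : ℝ≥0∞) • (κ.map Prod.fst + κ.map Prod.snd) with hs
  set s' : Measure (X × X) := (2⁻¹ : ℝ≥0∞) • (κ.map (fun z => (z.1.1, z.2.2)) +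
    κ.map (fun z => (z.2.1, z.1.2))) with hs'
  have hle : s ≤ π := by
    refine Measure.le_iff.2 fun t ht => ?_
    simp only [hs, Measure.smul_apply, Measure.add_apply, smul_eq_mul]
    calc 2⁻¹ * (κ.map Prod.fst t + κ.map Prod.snd t) ≤ 2⁻¹ * (π t + π t) := by
          exact mul_le_mul_right (add_le_add (h1 t) (h2 t)) _
      _ = π t := by
          rw [← two_mul, ← mul_assoc, ENNReal.inv_mul_cancel (by simp) (by simp), one_mul]
  have : IsFiniteMeasure s := ⟨(hle univ).trans_lt (measure_lt_top _ _)⟩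
  have hπ : π - s + s = π := Measure.sub_add_cancel_of_le hle
  have m1 : Measurable (fun z : (X × X) × (X × X) => (z.1.1, z.2.2)) := by fun_prop
  have m2 : Measurable (fun z : (X × X) × (X × X) => (z.2.1, z.1.2)) := by fun_prop
  refine ⟨π - s + s', ?_, ?_, ?_⟩
  · conv_rhs => rw [← hπ]
    rw [Measure.map_add _ _ measurable_fst, Measure.map_add _ _ measurable_fst]
    congr 1
    simp only [hs, hs', Measure.map_smul, Measure.map_add _ _ measurable_fst]
    rw [Measure.map_map measurable_fst m1, Measure.map_map measurable_fst m2,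
      Measure.map_map measurable_fst measurable_fst, Measure.map_map measurable_fst measurable_snd]
    rfl
  · conv_rhs => rw [← hπ]
    rw [Measure.map_add _ _ measurable_snd, Measure.map_add _ _ measurable_snd]
    congr 1
    simp only [hs, hs', Measure.map_smul, Measure.map_add _ _ measurable_snd]
    rw [Measure.map_map measurable_snd m1, Measure.map_map measurable_snd m2,
      Measure.map_map measurable_snd measurable_fst, Measure.map_map measurable_snd measurable_snd,
      add_comm]
    rfl
  · intro c hc
    have e1 : 2⁻¹ * ∫⁻ z, (c z.1 + c z.2) ∂κ = ∫⁻ p, c p ∂s := by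
      rw [hs, lintegral_smul_measure, lintegral_add_measure, lintegral_map hc measurable_fst,
        lintegral_map hc measurable_snd, lintegral_add_left (by fun_prop)]
      rfl
    have e2 : 2⁻¹ * ∫⁻ z, (c (z.1.1, z.2.2) + c (z.2.1, z.1.2)) ∂κ = ∫⁻ p, c p ∂s' := by
      rw [hs', lintegral_smul_measure, lintegral_add_measure, lintegral_map hc m1,
        lintegral_map hc m2, lintegral_add_left (by fun_prop)]
      rfl
    rw [e1, e2]
    conv_rhs => rw [← hπ]
    rw [lintegral_add_measure, lintegral_add_measure]
    ring

/-- Bundled consequences of swapping. -/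
lemma swap_cost {X : Type*} [MeasurableSpace X] (π : Measure (X × X)) [IsFiniteMeasure π]
    (κ : Measure ((X × X) × (X × X))) (h0 : κ ≠ 0)
    (h1 : κ.map Prod.fst ≤ π) (h2 : κ.map Prod.snd ≤ π) :
    ∃ π' : Measure (X × X), π'.map Prod.fst = π.map Prod.fst ∧ π'.map Prod.snd = π.map Prod.snd ∧
      ∀ c : X × X → ℝ≥0∞, Measurable c → ∫⁻ p, c p ∂π ≠ ⊤ →
        ((∀ᵐ z ∂κ, c (z.1.1, z.2.2) + c (z.2.1, z.1.2) ≤ c z.1 + c z.2) →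
          ∫⁻ p, c p ∂π' ≤ ∫⁻ p, c p ∂π) ∧
        ((∀ᵐ z ∂κ, c (z.1.1, z.2.2) + c (z.2.1, z.1.2) < c z.1 + c z.2) →
          ∫⁻ p, c p ∂π' < ∫⁻ p, c p ∂π) := by
  obtain ⟨π', a1, a2, a3⟩ := swap_exists π κ h1 h2
  refine ⟨π', a1, a2, fun c hc hfin => ?_⟩
  have e := a3 c hc
  have hf : 2⁻¹ * ∫⁻ z, (c z.1 + c z.2) ∂κ ≠ ⊤ := by
    rw [lintegral_add_left (by fun_prop)]
    have f1 : ∫⁻ z, c z.1 ∂κ ≠ ⊤ := by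
      rw [← lintegral_map hc measurable_fst]
      exact ne_top_of_le_ne_top hfin (lintegral_mono' h1 le_rfl)
    have f2 : ∫⁻ z, c z.2 ∂κ ≠ ⊤ := by
      rw [← lintegral_map hc measurable_snd]
      exact ne_top_of_le_ne_top hfin (lintegral_mono' h2 le_rfl)
    finiteness
  constructor
  · intro h
    have : 2⁻¹ * ∫⁻ z, (c (z.1.1, z.2.2) + c (z.2.1, z.1.2)) ∂κ ≤
        2⁻¹ * ∫⁻ z, (c z.1 + c z.2) ∂κ := by
      gcongr 2⁻¹ * ?_
      exact lintegral_mono_ae h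
    refine (ENNReal.add_le_add_iff_right hf).1 ?_
    rw [e]
    gcongr
  · intro h
    have : 2⁻¹ * ∫⁻ z, (c (z.1.1, z.2.2) + c (z.2.1, z.1.2)) ∂κ <
        2⁻¹ * ∫⁻ z, (c z.1 + c z.2) ∂κ := by
      have hne : ∫⁻ z, (c z.1 + c z.2) ∂κ ≠ ⊤ := by
        intro h; rw [h] at hf; simp at hf
      refine ENNReal.mul_lt_mul_right (by simp) (by simp) ?_
      refine lintegral_strict_mono h0 (by fun_prop) ?_ h
      exact ne_top_of_le_ne_top hne (lintegral_mono_ae (h.mono fun _ hx => hx.le))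
    refine (ENNReal.add_lt_add_iff_right hf).1 ?_
    rw [e]
    exact (ENNReal.add_lt_add_iff_left hfin).2 this


/-- The auxiliary strictly convex function. -/
def hh {d : ℕ} (z : Euc d) : ℝ := Real.sqrt (1 + ‖z‖ ^ 2)

lemma hh_pos {d : ℕ} (z : Euc d) : 0 < hh z := Real.sqrt_pos.2 (by positivity)

lemma hh_sq {d : ℕ} (z : Euc d) : hh z ^ 2 = 1 + ‖z‖ ^ 2 := Real.sq_sqrt (by positivity)

lemma hh_cont {d : ℕ} : Continuous (hh : Euc d → ℝ) := by
  unfold hh; fun_prop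

/-- the gradient paired with a direction -/
def gg {d : ℕ} (z v : Euc d) : ℝ := inner ℝ z v / hh z

lemma gg_cont {d : ℕ} : Continuous (fun p : Euc d × Euc d => gg p.1 p.2) := by
  unfold gg
  refine Continuous.div (by fun_prop) (hh_cont.comp continuous_fst) fun p => (hh_pos _).ne'

lemma gg_sub {d : ℕ} (z v w : Euc d) : gg z (v - w) = gg z v - gg z w := by
  simp [gg, inner_sub_right, sub_div]

lemma gg_smul {d : ℕ} (z v : Euc d) (t : ℝ) : gg z (t • v) = t * gg z v := by
  simp [gg, inner_smul_right, mul_div_assoc]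

lemma gg_add {d : ℕ} (z v w : Euc d) : gg z (v + w) = gg z v + gg z w := by
  simp [gg, inner_add_right, add_div]

lemma hh_grad_lt {d : ℕ} {z w : Euc d} (h : w ≠ z) : hh z + gg z (w - z) < hh w := by
  have hz := hh_pos z
  have hw := hh_pos w
  have e : hh z + gg z (w - z) = (1 + inner ℝ z w) / hh z := by
    rw [eq_div_iff hz.ne']
    unfold gg
    rw [add_mul, div_mul_cancel₀ _ hz.ne', inner_sub_right, real_inner_self_eq_norm_sq]
    nlinarith [hh_sq z]
  rw [e, div_lt_iff₀ hz]
  have hpos : 0 < ‖w - z‖ ^ 2 := by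
    have : 0 < ‖w - z‖ := norm_pos_iff.2 (sub_ne_zero.2 h)
    positivity
  rw [norm_sub_sq_real, real_inner_comm] at hpos
  have hcs := abs_real_inner_le_norm z w
  have hcs2 : (inner ℝ z w) ^ 2 ≤ (‖z‖ * ‖w‖) ^ 2 := sq_le_sq' (by linarith [neg_abs_le (inner ℝ z w)]) (le_trans (le_abs_self _) hcs)
  have : (1 + inner ℝ z w) ^ 2 < (hh w * hh z) ^ 2 := by
    rw [mul_pow, hh_sq, hh_sq]
    nlinarith
  exact lt_of_pow_lt_pow_left₀ 2 (by positivity) this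

lemma hh_grad {d : ℕ} (z w : Euc d) : hh z + gg z (w - z) ≤ hh w := by
  by_cases h : w = z
  · subst h; simp [gg]
  · exact (hh_grad_lt h).le

lemma hh_strict {d : ℕ} {a b : Euc d} (h : a ≠ b) {t : ℝ} (h0 : 0 < t) (h1 : t < 1) :
    hh ((1 - t) • b + t • a) < (1 - t) * hh b + t * hh a := by
  set m := (1 - t) • b + t • a with hm
  have ea : a - m = (1 - t) • (a - b) := by rw [hm]; module
  have eb : b - m = (-t) • (a - b) := by rw [hm]; module
  have hb' : b ≠ m := by
    intro hc
    have := eb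
    rw [← hc, sub_self] at this
    rcases smul_eq_zero.1 this.symm with h2 | h2
    · linarith
    · exact h (sub_eq_zero.1 h2)
  have ha := hh_grad m a
  have hb := hh_grad_lt hb'
  rw [ea, gg_smul] at ha
  rw [eb, gg_smul] at hb
  nlinarith [mul_le_mul_of_nonneg_left ha h0.le, mul_lt_mul_of_pos_left hb (sub_pos.2 h1)]

lemma hh_gap {d : ℕ} {a b : Euc d} {t : ℝ} (ht : 0 < t) (h : gg b a < gg ((1 - t) • a) a) :
    hh b + hh ((1 - t) • a) < hh a + hh (b - t • a) := by
  have h1 := hh_grad ((1 - t) • a) a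
  have h2 := hh_grad b (b - t • a)
  have e1 : a - (1 - t) • a = t • a := by module
  have e2 : b - t • a - b = (-t) • a := by module
  rw [e1, gg_smul] at h1
  rw [e2, gg_smul] at h2
  nlinarith

lemma gg_mono {d : ℕ} {a b : Euc d} (h : a ≠ b) : gg b a < gg a a ∨ gg a b < gg b b := by
  have h1 := hh_grad_lt h
  have h2 := hh_grad_lt h.symm
  rw [gg_sub] at h1 h2
  by_contra! hc
  linarith [hc.1, hc.2]

lemma gg_le {d : ℕ} (z v : Euc d) : |gg z v| ≤ ‖v‖ := by
  unfold gg
  rw [abs_div, abs_of_pos (hh_pos z), div_le_iff₀ (hh_pos z)]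
  refine (abs_real_inner_le_norm z v).trans ?_
  rw [mul_comm]
  gcongr
  refine Real.le_sqrt_of_sq_le ?_
  linarith

lemma hh_lip {d : ℕ} (z w : Euc d) : hh z ≤ hh w + ‖w - z‖ := by
  have := hh_grad z w
  have h2 := gg_le z (w - z)
  linarith [neg_abs_le (gg z (w - z))]

lemma hh_le {d : ℕ} (z : Euc d) : hh z ≤ 1 + ‖z‖ := by
  refine Real.sqrt_le_iff.2 ⟨by positivity, ?_⟩
  nlinarith [norm_nonneg z]

/-- properties of an asymmetric norm -/
structure GC {d : ℕ} (c : Euc d → ℝ) (L : ℝ) : Prop where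
  cont : Continuous c
  nonneg : ∀ z, 0 ≤ c z
  add : ∀ z w, c (z + w) ≤ c z + c w
  smul : ∀ t : ℝ, 0 ≤ t → ∀ z, c (t • z) = t * c z
  Lpos : 0 < L
  up : ∀ z, c z ≤ L * ‖z‖
  low : ∀ z, ‖z‖ ≤ L * c z

lemma gauge_GC {d : ℕ} (D : Set (Euc d))
    (hDcp : IsCompact D) (hDcv : Convex ℝ D) (hD0 : (0 : Euc d) ∈ interior D) :
    ∃ L, GC (gauge D) L := by
  have hn : D ∈ nhds (0 : Euc d) := mem_interior_iff_mem_nhds.1 hD0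
  obtain ⟨r, hr, hrD⟩ := Metric.mem_nhds_iff.1 hn
  obtain ⟨R, hR⟩ := hDcp.isBounded.subset_closedBall (0 : Euc d)
  have habs : Absorbent ℝ D := absorbent_nhds_zero hn
  have hR' : D ⊆ Metric.closedBall 0 (max R 1) :=
    hR.trans (Metric.closedBall_subset_closedBall (le_max_left _ _))
  have hR1 : (0 : ℝ) < max R 1 := lt_of_lt_of_le one_pos (le_max_right _ _)
  refine ⟨max r⁻¹ (max R 1), continuous_gauge hDcv hn, gauge_nonneg, gauge_add_le hDcv habs,
    fun t ht z => by simpa using gauge_smul_of_nonneg ht z, lt_max_of_lt_right hR1, fun z => ?_, fun z => ?_⟩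
  · have := mul_gauge_le_norm (x := z) hrD
    calc gauge D z ≤ r⁻¹ * ‖z‖ := by
          rw [le_inv_mul_iff₀ hr]; exact this
      _ ≤ _ := by gcongr; exact le_max_left _ _
  · have := le_gauge_of_subset_closedBall (x := z) habs hR1.le hR'
    rw [div_le_iff₀ hR1, mul_comm] at this
    refine this.trans ?_
    exact mul_le_mul_of_nonneg_right (le_max_right _ _) (gauge_nonneg _)


lemma coupling_prob {d : ℕ} {μ ν : Measure (Euc d)} [IsProbabilityMeasure μ]
    {π : Measure (Euc d × Euc d)} (h : IsCoupling π μ ν) : IsProbabilityMeasure π := by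
  refine ⟨?_⟩
  rw [← Set.preimage_univ (f := (Prod.fst : Euc d × Euc d → Euc d)),
    ← Measure.map_apply measurable_fst MeasurableSet.univ, h.1]
  simp

open Filter Topology in
lemma exists_limit {d : ℕ} (μ ν : Measure (Euc d)) [IsProbabilityMeasure μ] [IsProbabilityMeasure ν]
    (Q : ℕ → Euc d → Euc d) (hQ : ∀ n, Measurable (Q n)) (r : ℕ → ℝ) (hr1 : ∀ n, r n ≤ 1)
    (hr0 : Tendsto r atTop (𝓝 0)) (hQr : ∀ n y, dist (Q n y) y ≤ r n)
    (π : ℕ → Measure (Euc d × Euc d)) (hπ : ∀ n, IsCoupling (π n) μ (ν.map (Q n))) :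
    ∃ (φ : ℕ → ℕ) (π' : Measure (Euc d × Euc d)), StrictMono φ ∧ IsCoupling π' μ ν ∧
      ∀ G, IsOpen G → π' G ≤ atTop.liminf (fun n => π (φ n) G) := by
  have hp : ∀ n, IsProbabilityMeasure (π n) := fun n => coupling_prob (hπ n)
  let P : ℕ → ProbabilityMeasure (Euc d × Euc d) := fun n => ⟨π n, hp n⟩
  have hνn : ∀ n, IsProbabilityMeasure (ν.map (Q n)) := fun n =>
    Measure.isProbabilityMeasure_map (hQ n).aemeasurable
  have htight : IsTightMeasureSet {((m : ProbabilityMeasure (Euc d × Euc d)) :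
      Measure (Euc d × Euc d)) | m ∈ range P} := by
    apply IsTightMeasureSet.prodMk
    · refine (isTightMeasureSet_singleton (μ := μ)).subset ?_
      rintro _ ⟨_, ⟨_, ⟨n, rfl⟩, rfl⟩, rfl⟩
      exact (hπ n).1
    · have ht := isTightMeasureSet_singleton (μ := ν)
      rw [isTightMeasureSet_iff_exists_isCompact_measure_compl_le] at ht ⊢
      intro ε hε
      obtain ⟨K, hK, hKε⟩ := ht ε hε
      obtain ⟨R, hR⟩ := hK.isBounded.subset_closedBall (0 : Euc d)
      refine ⟨Metric.closedBall 0 (R + 1), isCompact_closedBall _ _, ?_⟩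
      rintro _ ⟨_, ⟨_, ⟨n, rfl⟩, rfl⟩, rfl⟩
      have : (P n : Measure (Euc d × Euc d)).snd = ν.map (Q n) := (hπ n).2
      rw [this, Measure.map_apply (hQ n) measurableSet_closedBall.compl]
      refine (measure_mono ?_).trans (hKε ν rfl)
      intro y hy hyK
      apply hy
      have h1 : dist y 0 ≤ R := hR hyK
      have h2 := hQr n y
      have h3 := hr1 n
      show dist (Q n y) 0 ≤ R + 1
      linarith [dist_triangle (Q n y) y 0]
  have hcomp := isCompact_closure_of_isTightMeasureSet htight
  obtain ⟨P', -, φ, hφ, hlim⟩ := hcomp.tendsto_subseq (x := P) (fun n => subset_closure ⟨n, rfl⟩)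
  refine ⟨φ, P', hφ, ⟨?_, ?_⟩, fun G hG => ?_⟩
  · have h1 := ProbabilityMeasure.tendsto_map_of_tendsto_of_continuous _ _ hlim
      (f := Prod.fst) continuous_fst
    have h2 : ∀ n, ((P ∘ φ) n).map (f := Prod.fst) continuous_fst.aemeasurable =
        (⟨μ, inferInstance⟩ : ProbabilityMeasure (Euc d)) := fun n => by
      apply Subtype.ext
      exact (hπ (φ n)).1
    simp only [h2] at h1
    have := tendsto_nhds_unique h1 tendsto_const_nhds
    exact congrArg Subtype.val this
  · let Nn : ℕ → ProbabilityMeasure (Euc d) := fun n => ⟨ν.map (Q (φ n)), hνn _⟩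
    let N : ProbabilityMeasure (Euc d) := ⟨ν, inferInstance⟩
    have h1 := ProbabilityMeasure.tendsto_map_of_tendsto_of_continuous _ _ hlim
      (f := Prod.snd) continuous_snd
    have h2 : ∀ n, ((P ∘ φ) n).map (f := Prod.snd) continuous_snd.aemeasurable =
        Nn n := fun n => by
      apply Subtype.ext
      exact (hπ (φ n)).2
    simp only [h2] at h1
    have h3 : Tendsto Nn atTop (𝓝 N) := by
      rw [ProbabilityMeasure.tendsto_iff_forall_integral_tendsto]
      intro f
      simp only [ProbabilityMeasure.coe_mk, Nn, N]
      have : ∀ n, ∫ y, f y ∂(ν.map (Q (φ n))) = ∫ y, f (Q (φ n) y) ∂ν := fun n =>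
        integral_map (hQ _).aemeasurable f.continuous.aestronglyMeasurable
      simp only [this]
      refine tendsto_integral_of_dominated_convergence (fun _ => ‖f‖) ?_ (by fun_prop) ?_ ?_
      · intro n
        exact (f.continuous.measurable.comp (hQ _)).aestronglyMeasurable
      · exact fun n => Eventually.of_forall fun y => f.norm_coe_le_norm _
      · refine Eventually.of_forall fun y => ?_
        refine (f.continuous.tendsto y).comp ?_
        rw [tendsto_iff_dist_tendsto_zero]
        exact squeeze_zero (fun _ => dist_nonneg) (fun n => hQr (φ n) y)
          (hr0.comp hφ.tendsto_atTop)
    have := tendsto_nhds_unique h1 h3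
    exact congrArg Subtype.val this
  · exact ProbabilityMeasure.le_liminf_measure_open_of_tendsto hlim hG

/-- general translation invariant cost -/
def KK {d : ℕ} (g : Euc d → ℝ) (p : Euc d × Euc d) : ℝ≥0∞ := ENNReal.ofReal (g (p.2 - p.1))

lemma KK_meas {d : ℕ} {g : Euc d → ℝ} (hg : Continuous g) : Measurable (KK g) := by
  unfold KK
  have : Continuous fun p : Euc d × Euc d => g (p.2 - p.1) := by fun_prop
  exact this.measurable.ennreal_ofReal

open Filter Topology in
lemma KK_lsc {d : ℕ} {g : Euc d → ℝ} (hg : Continuous g) (h0 : ∀ z, 0 ≤ g z)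
    (π : ℕ → Measure (Euc d × Euc d)) (π' : Measure (Euc d × Euc d))
    (h : ∀ G, IsOpen G → π' G ≤ atTop.liminf (fun n => π n G))
    (v : ℕ → ℝ≥0∞) (l : ℝ≥0∞) (hv : ∀ n, ∫⁻ p, KK g p ∂(π n) ≤ v n) (hl : Tendsto v atTop (𝓝 l)) :
    ∫⁻ p, KK g p ∂π' ≤ l := by
  have hc : Continuous fun p : Euc d × Euc d => g (p.2 - p.1) := by fun_prop
  refine (lintegral_le_liminf_lintegral_of_forall_isOpen_measure_le_liminf_measure hc
    (fun p => h0 _) h).trans ?_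
  refine (liminf_le_liminf (Eventually.of_forall hv)).trans ?_
  exact hl.liminf_eq.le

open Filter Topology in
lemma exists_min {d : ℕ} {g : Euc d → ℝ} (hg : Continuous g) (h0 : ∀ z, 0 ≤ g z)
    (μ ν : Measure (Euc d)) [IsProbabilityMeasure μ] [IsProbabilityMeasure ν] :
    ∃ π, IsCoupling π μ ν ∧ ∀ π', IsCoupling π' μ ν → ∫⁻ p, KK g p ∂π ≤ ∫⁻ p, KK g p ∂π' := by
  set S : Set ℝ≥0∞ := (fun π => ∫⁻ p, KK g p ∂π) '' {π | IsCoupling π μ ν} with hS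
  have hne : S.Nonempty := by
    refine ⟨_, μ.prod ν, ⟨?_, ?_⟩, rfl⟩
    · rw [Measure.map_fst_prod]; simp
    · rw [Measure.map_snd_prod]; simp
  obtain ⟨u, -, hu, huS⟩ := exists_seq_tendsto_sInf hne (OrderBot.bddBelow S)
  choose π hπ hπu using huS
  obtain ⟨φ, π', hφ, hc, hG⟩ := exists_limit μ ν (fun _ => id) (fun _ => measurable_id) (fun _ => 0)
    (by simp) tendsto_const_nhds (by simp) π (by simpa using hπ)
  refine ⟨π', hc, fun π'' h'' => ?_⟩
  have := KK_lsc hg h0 _ π' hG (fun n => u (φ n)) (sInf S) (fun n => (hπu _).le)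
    (hu.comp hφ.tendsto_atTop)
  exact this.trans (sInf_le ⟨π'', h'', rfl⟩)


lemma ofReal_add_le4 {a b c e : ℝ} (ha : 0 ≤ a) (hb : 0 ≤ b) (hc : 0 ≤ c) (he : 0 ≤ e)
    (h : a + b ≤ c + e) : ENNReal.ofReal a + ENNReal.ofReal b ≤ ENNReal.ofReal c + ENNReal.ofReal e := by
  rw [← ENNReal.ofReal_add ha hb, ← ENNReal.ofReal_add hc he]
  exact ENNReal.ofReal_le_ofReal h

lemma ofReal_add_lt4 {a b c e : ℝ} (ha : 0 ≤ a) (hb : 0 ≤ b) (hc : 0 ≤ c) (he : 0 ≤ e)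
    (h : a + b < c + e) : ENNReal.ofReal a + ENNReal.ofReal b < ENNReal.ofReal c + ENNReal.ofReal e := by
  rw [← ENNReal.ofReal_add ha hb, ← ENNReal.ofReal_add hc he]
  exact (ENNReal.ofReal_lt_ofReal_iff_of_nonneg (by positivity)).2 h

/-- interpolation map -/
def SS {d : ℕ} (t : ℝ) (p : Euc d × Euc d) : Euc d := (1 - t) • p.1 + t • p.2

lemma SS_cont {d : ℕ} (t : ℝ) : Continuous (SS t : Euc d × Euc d → Euc d) := by
  unfold SS; fun_prop

/-- sublevel set of the density of `μ` -/
def GM {d : ℕ} (μ : Measure (Euc d)) (M : NNReal) : Set (Euc d) := {x | μ.rnDeriv volume x ≤ M}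

lemma GM_meas {d : ℕ} (μ : Measure (Euc d)) (M : NNReal) : MeasurableSet (GM μ M) :=
  measurableSet_le (Measure.measurable_rnDeriv _ _) measurable_const

/-- constant of contraction -/
def CC (d : ℕ) (t : ℝ) : ℝ≥0∞ := ENNReal.ofReal |((1 - t) ^ Module.finrank ℝ (Euc d))⁻¹|

/-- absolute continuity property of the interpolations -/
def ACP {d : ℕ} (μ : Measure (Euc d)) (π : Measure (Euc d × Euc d)) : Prop :=
  ∀ (M : NNReal) (t : ℝ), 0 ≤ t → t < 1 → ∀ E, MeasurableSet E →
    π (Prod.fst ⁻¹' GM μ M ∩ SS t ⁻¹' E) ≤ M * CC d t * volume E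

open Filter Topology in
lemma AC_limit {d : ℕ} (μ ν : Measure (Euc d)) [IsProbabilityMeasure μ]
    (π : ℕ → Measure (Euc d × Euc d)) (π' : Measure (Euc d × Euc d))
    (h : ∀ G, IsOpen G → π' G ≤ atTop.liminf (fun n => π n G))
    (hπ : ∀ n, (π n).map Prod.fst = μ) (hac : ∀ n, ACP μ (π n)) : ACP μ π' := by
  intro M t ht0 ht1 E hE
  have hfin : (M : ℝ≥0∞) * CC d t ≠ ⊤ := by unfold CC; finiteness
  have : Measure.OuterRegular (((M : ℝ≥0∞) * CC d t) • (volume : Measure (Euc d))) :=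
    Measure.OuterRegular.smul _ hfin
  have e := Set.measure_eq_iInf_isOpen E (((M : ℝ≥0∞) * CC d t) • (volume : Measure (Euc d)))
  rw [Measure.smul_apply, smul_eq_mul] at e
  rw [e]
  refine le_iInf fun U => le_iInf fun hEU => le_iInf fun hU => ?_
  rw [Measure.smul_apply, smul_eq_mul]
  refine ENNReal.le_of_forall_pos_le_add fun ε hε _ => ?_
  obtain ⟨V, hGV, hV, hVε⟩ := Set.exists_isOpen_le_add (GM μ M) μ
    (ε := ε) (by simpa using hε.ne')
  have hd : μ (V \ GM μ M) ≤ ε := by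
    rw [measure_diff_le_iff_le_add (GM_meas μ M).nullMeasurableSet hGV (measure_ne_top _ _)]
    exact hVε
  calc π' (Prod.fst ⁻¹' GM μ M ∩ SS t ⁻¹' E) ≤ π' (Prod.fst ⁻¹' V ∩ SS t ⁻¹' U) := by
        apply measure_mono
        exact inter_subset_inter (preimage_mono hGV) (preimage_mono hEU)
    _ ≤ atTop.liminf (fun n => π n (Prod.fst ⁻¹' V ∩ SS t ⁻¹' U)) :=
        h _ ((hV.preimage continuous_fst).inter (hU.preimage (SS_cont t)))
    _ ≤ atTop.liminf (fun _ : ℕ => M * CC d t * volume U + ε) := by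
        refine liminf_le_liminf (Eventually.of_forall fun n => ?_)
        have hsub : (Prod.fst ⁻¹' V ∩ SS t ⁻¹' U : Set (Euc d × Euc d)) ⊆
            (Prod.fst ⁻¹' GM μ M ∩ SS t ⁻¹' U) ∪ Prod.fst ⁻¹' (V \ GM μ M) := by
          intro p hp
          by_cases hg : p.1 ∈ GM μ M
          · exact Or.inl ⟨hg, hp.2⟩
          · exact Or.inr ⟨hp.1, hg⟩
        refine (measure_mono hsub).trans ((measure_union_le _ _).trans ?_)
        refine add_le_add (hac n M t ht0 ht1 U hU.measurableSet) ?_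
        rw [← Measure.map_apply measurable_fst (hV.measurableSet.diff (GM_meas μ M)), hπ n]
        exact hd
    _ = _ := liminf_const _

lemma mu_bound {d : ℕ} (μ : Measure (Euc d)) [IsProbabilityMeasure μ] (hac : μ ≪ volume)
    (M : NNReal) (A : Set (Euc d)) : μ (GM μ M ∩ A) ≤ M * volume A := by
  rw [← Measure.setLIntegral_rnDeriv hac]
  calc ∫⁻ x in GM μ M ∩ A, μ.rnDeriv volume x ≤ ∫⁻ x in GM μ M ∩ A, (M : ℝ≥0∞) := by
        rw [inter_comm, ← Measure.restrict_restrict_of_subset (s := A ∩ GM μ M) (t := GM μ M) inter_subset_right]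
        refine lintegral_mono_ae ?_
        refine ae_restrict_of_ae ?_
        exact (ae_restrict_iff' (GM_meas μ M)).2 (Filter.Eventually.of_forall fun x hx => hx)
    _ = M * volume (GM μ M ∩ A) := by simp
    _ ≤ _ := by gcongr; exact inter_subset_right

lemma vol_pre {d : ℕ} {t : ℝ} (ht : t < 1) (y : Euc d) (A : Set (Euc d)) :
    volume {x : Euc d | (1 - t) • x + t • y ∈ A} = CC d t * volume A := by
  have : {x : Euc d | (1 - t) • x + t • y ∈ A} =
      (fun x => (1 - t) • x) ⁻¹' ((fun x => x + t • y) ⁻¹' A) := rfl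
  rw [this, Measure.addHaar_preimage_smul _ (by linarith), measure_preimage_add_right]
  rfl

lemma sing_lemma {d : ℕ} {c : Euc d → ℝ} {L : ℝ} (hc : GC c L) {ε : ℝ} (hε : 0 < ε)
    (μ ν : Measure (Euc d)) [IsProbabilityMeasure μ] (π : Measure (Euc d × Euc d))
    (hπ : IsCoupling π μ ν)
    (hmin : ∀ π', IsCoupling π' μ ν →
      ∫⁻ p, KK (fun z => c z + ε * hh z) p ∂π ≤ ∫⁻ p, KK (fun z => c z + ε * hh z) p ∂π')
    (hfin : ∫⁻ p, KK (fun z => c z + ε * hh z) p ∂π ≠ ⊤)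
    {t : ℝ} (ht0 : 0 < t) (ht1 : t < 1) {y y' : Euc d} (hy : y ≠ y') :
    (π.restrict (Prod.snd ⁻¹' {y})).map (SS t) ⟂ₘ (π.restrict (Prod.snd ⁻¹' {y'})).map (SS t) := by
  by_contra hns
  have := coupling_prob hπ
  have hnn : ∀ z : Euc d, 0 ≤ c z + ε * hh z := fun z =>
    add_nonneg (hc.nonneg z) (mul_nonneg hε.le (hh_pos z).le)
  obtain ⟨κ, k0, k1, k2, k3⟩ := glue _ _ _ _ (SS_cont t).measurable (SS_cont t).measurable hns
  obtain ⟨π', a1, a2, a3⟩ := swap_cost π κ k0 (k1.trans Measure.restrict_le_self)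
    (k2.trans Measure.restrict_le_self)
  have hcont : Continuous (fun z : Euc d => c z + ε * hh z) :=
    hc.cont.add (continuous_const.mul hh_cont)
  have hlt := (a3 _ (KK_meas hcont) hfin).2 ?_
  · exact absurd (hmin π' ⟨a1.trans hπ.1, a2.trans hπ.2⟩) (not_le.2 hlt)
  · have b : ∀ w : Euc d, ∀ᵐ z ∂(π.restrict (Prod.snd ⁻¹' {w})), z.2 = w := fun w =>
      ae_restrict_mem (measurable_snd (measurableSet_singleton w))
    have b1 : ∀ᵐ z ∂κ, z.1.2 = y :=
      ae_of_ae_map measurable_fst.aemeasurable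
        ((Measure.absolutelyContinuous_of_le k1).ae_le (b y))
    have b2 : ∀ᵐ z ∂κ, z.2.2 = y' :=
      ae_of_ae_map measurable_snd.aemeasurable
        ((Measure.absolutelyContinuous_of_le k2).ae_le (b y'))
    filter_upwards [b1, b2, k3] with ⟨⟨x, u⟩, ⟨x', u'⟩⟩ h1 h2 h3
    simp only at h1 h2 h3
    subst h1 h2
    simp only [SS] at h3
    unfold KK
    refine ofReal_add_lt4 (hnn _) (hnn _) (hnn _) (hnn _) ?_
    simp only
    have ex : (1 - t) • (x - x') = t • (u' - u) := by
      have : (1 - t) • (x - x') - t • (u' - u) =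
        ((1 - t) • x + t • u) - ((1 - t) • x' + t • u') := by module
      rw [h3, sub_self] at this
      exact sub_eq_zero.1 this
    set a := u - x with ha
    set b := u' - x' with hb
    have e1 : u' - x = (1 - t) • b + t • a := by
      have : u' - x - ((1 - t) • b + t • a) = t • (u' - u) - (1 - t) • (x - x') := by
        rw [ha, hb]; module
      rw [ex, sub_self] at this
      exact sub_eq_zero.1 this
    have e2 : u - x' = (1 - t) • a + t • b := by
      have : u - x' - ((1 - t) • a + t • b) = (1 - t) • (x - x') - t • (u' - u) := by
        rw [ha, hb]; module
      rw [ex, sub_self] at this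
      exact sub_eq_zero.1 this
    have hab : a ≠ b := by
      intro hab
      have h5 : u' - x = a := by rw [e1, ← hab]; module
      apply hy
      have : u' - x = u - x := h5
      exact (sub_left_injective this).symm
    rw [e1, e2]
    have s1 := hh_strict hab ht0 ht1
    have s2 := hh_strict hab.symm ht0 ht1
    have cc : ∀ v w : Euc d, c ((1 - t) • v + t • w) ≤ (1 - t) * c v + t * c w := fun v w => by
      refine (hc.add _ _).trans ?_
      rw [hc.smul _ (by linarith), hc.smul _ ht0.le]
    have c1 := cc a b
    have c2 := cc b a
    nlinarith [mul_lt_mul_of_pos_left s1 hε, mul_lt_mul_of_pos_left s2 hε]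

lemma AC_discrete {d : ℕ} {c : Euc d → ℝ} {L : ℝ} (hc : GC c L) {ε : ℝ} (hε : 0 < ε)
    (μ ν : Measure (Euc d)) [IsProbabilityMeasure μ] (hac : μ ≪ volume)
    (π : Measure (Euc d × Euc d)) (hπ : IsCoupling π μ ν)
    (hmin : ∀ π', IsCoupling π' μ ν →
      ∫⁻ p, KK (fun z => c z + ε * hh z) p ∂π ≤ ∫⁻ p, KK (fun z => c z + ε * hh z) p ∂π')
    (hfin : ∫⁻ p, KK (fun z => c z + ε * hh z) p ∂π ≠ ⊤)
    (Y : Set (Euc d)) (hY : Y.Countable) (hνY : ν Yᶜ = 0) : ACP μ π := by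
  classical
  intro M t ht0 ht1 E hE
  rcases ht0.eq_or_lt with rfl | ht0
  · have hS : (SS 0 : Euc d × Euc d → Euc d) = Prod.fst := by
      funext p; simp [SS]
    have hC : CC d 0 = 1 := by simp [CC]
    rw [hS, hC, mul_one, ← preimage_inter, ← Measure.map_apply measurable_fst ((GM_meas μ M).inter hE),
      hπ.1]
    exact mu_bound μ hac M E
  have : Countable Y := hY.to_subtype
  let l : Y → Measure (Euc d) := fun i => (π.restrict (Prod.snd ⁻¹' {(i : Euc d)})).map (SS t)
  have hs : ∀ i j : Y, i ≠ j → l i ⟂ₘ l j := fun i j hij =>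
    sing_lemma hc hε μ ν π hπ hmin hfin ht0 ht1 (fun h => hij (Subtype.ext h))
  have hN : ∀ i j : Y, ∃ N : Set (Euc d), MeasurableSet N ∧ (i ≠ j → l i N = 0 ∧ l j Nᶜ = 0) := by
    intro i j
    by_cases hij : i = j
    · exact ⟨∅, MeasurableSet.empty, fun h => absurd hij h⟩
    · obtain ⟨s, h1, h2, h3⟩ := hs i j hij
      exact ⟨s, h1, fun _ => ⟨h2, h3⟩⟩
  choose N hNm hN using hN
  let B : Y → Set (Euc d) := fun i => {x | ∀ j, j ≠ i → x ∉ N i j ∧ x ∈ N j i}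
  have hB : ∀ i, B i = ⋂ j, ⋂ (_ : j ≠ i), ((N i j)ᶜ ∩ N j i) := by
    intro i; ext x; simp [B]
  have hBm : ∀ i, MeasurableSet (B i) := fun i => by
    rw [hB]
    exact MeasurableSet.iInter fun j => MeasurableSet.iInter fun _ => (hNm i j).compl.inter (hNm j i)
  have hBn : ∀ i, l i (B i)ᶜ = 0 := fun i => by
    rw [hB]
    simp only [compl_iInter]
    refine measure_iUnion_null fun j => measure_iUnion_null fun hj => ?_
    rw [compl_inter, compl_compl]
    exact measure_union_null (hN i j hj.symm).1 (hN j i hj).2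
  have hdis : Pairwise (Function.onFun Disjoint B) := by
    intro i j hij
    rw [Function.onFun, Set.disjoint_left]
    intro x hx hx'
    exact (hx j hij.symm).1 (hx' i hij).2
  set A : Set (Euc d × Euc d) := Prod.fst ⁻¹' GM μ M ∩ SS t ⁻¹' E with hA
  have hcover : A ⊆ (⋃ i : Y, A ∩ Prod.snd ⁻¹' {(i : Euc d)}) ∪ Prod.snd ⁻¹' Yᶜ := by
    intro p hp
    by_cases h : p.2 ∈ Y
    · exact Or.inl (mem_iUnion.2 ⟨⟨p.2, h⟩, hp, rfl⟩)
    · exact Or.inr h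
  have hYn : π (Prod.snd ⁻¹' Yᶜ) = 0 := by
    rw [← Measure.map_apply measurable_snd hY.measurableSet.compl, hπ.2, hνY]
  have hi : ∀ i : Y, π (A ∩ Prod.snd ⁻¹' {(i : Euc d)}) ≤ M * CC d t * volume (E ∩ B i) := by
    intro i
    have hsub : A ∩ Prod.snd ⁻¹' {(i : Euc d)} ⊆
        Prod.fst ⁻¹' (GM μ M ∩ {x | (1 - t) • x + t • (i : Euc d) ∈ E ∩ B i}) ∪
        (SS t ⁻¹' (B i)ᶜ ∩ Prod.snd ⁻¹' {(i : Euc d)}) := by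
      rintro p ⟨⟨h1, h2⟩, h3⟩
      by_cases h : SS t p ∈ B i
      · left
        refine ⟨h1, ?_⟩
        have h3 : p.2 = i := h3
        simp only [mem_setOf_eq, ← h3]
        exact ⟨h2, by simpa [SS] using h⟩
      · exact Or.inr ⟨h, h3⟩
    have hz : π (SS t ⁻¹' (B i)ᶜ ∩ Prod.snd ⁻¹' {(i : Euc d)}) = 0 := by
      have := hBn i
      simp only [l] at this
      rwa [Measure.map_apply (SS_cont t).measurable (hBm i).compl,
        Measure.restrict_apply ((SS_cont t).measurable (hBm i).compl)] at this
    have hmeas : MeasurableSet {x : Euc d | (1 - t) • x + t • (i : Euc d) ∈ E ∩ B i} := by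
      have hm : Measurable (fun x : Euc d => (1 - t) • x + t • (i : Euc d)) := by fun_prop
      exact hm (hE.inter (hBm i))
    refine (measure_mono hsub).trans ((measure_union_le _ _).trans ?_)
    rw [hz, add_zero, ← Measure.map_apply measurable_fst ((GM_meas μ M).inter hmeas), hπ.1]
    refine (mu_bound μ hac M _).trans ?_
    rw [vol_pre ht1, mul_assoc]
  calc π A ≤ π ((⋃ i : Y, A ∩ Prod.snd ⁻¹' {(i : Euc d)})) + π (Prod.snd ⁻¹' Yᶜ) :=
        (measure_mono hcover).trans (measure_union_le _ _)
    _ ≤ ∑' i : Y, π (A ∩ Prod.snd ⁻¹' {(i : Euc d)}) := by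
        rw [hYn, add_zero]; exact measure_iUnion_le _
    _ ≤ ∑' i : Y, M * CC d t * volume (E ∩ B i) := ENNReal.tsum_le_tsum hi
    _ = M * CC d t * volume (⋃ i, E ∩ B i) := by
        rw [ENNReal.tsum_mul_left, measure_iUnion _ fun i => hE.inter (hBm i)]
        intro i j hij
        exact (hdis hij).mono inter_subset_right inter_subset_right
    _ ≤ M * CC d t * volume E := by
        gcongr
        exact iUnion_subset fun i => inter_subset_left


lemma exists_round {d : ℕ} {η : ℝ} (hη : 0 < η) :
    ∃ Q : Euc d → Euc d, Measurable Q ∧ (range Q).Countable ∧ ∀ y, dist (Q y) y ≤ η := by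
  classical
  have hex : ∀ y : Euc d, ∃ n, dist (TopologicalSpace.denseSeq (Euc d) n) y < η := by
    intro y
    obtain ⟨n, hz⟩ := (TopologicalSpace.denseRange_denseSeq (Euc d)).exists_dist_lt y hη
    exact ⟨n, by rwa [dist_comm]⟩
  refine ⟨fun y => TopologicalSpace.denseSeq (Euc d) (Nat.find (hex y)), ?_, ?_, ?_⟩
  · refine (measurable_from_nat (f := TopologicalSpace.denseSeq (Euc d))).comp (measurable_find hex fun k => ?_)
    exact (isOpen_lt (by fun_prop) continuous_const).measurableSet
  · refine (countable_range (TopologicalSpace.denseSeq (Euc d))).mono ?_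
    rintro _ ⟨y, rfl⟩
    exact ⟨_, rfl⟩
  · intro y
    exact (Nat.find_spec (hex y)).le

lemma GCe_cont {d : ℕ} {c : Euc d → ℝ} {L : ℝ} (hc : GC c L) (ε : ℝ) :
    Continuous (fun z => c z + ε * hh z) := hc.cont.add (continuous_const.mul hh_cont)

lemma GCe_nonneg {d : ℕ} {c : Euc d → ℝ} {L : ℝ} (hc : GC c L) {ε : ℝ} (hε : 0 < ε) (z : Euc d) :
    0 ≤ c z + ε * hh z := by
  have := hc.nonneg z
  have := hh_pos z
  positivity

lemma round_coupling {d : ℕ} {c : Euc d → ℝ} {L : ℝ} (hc : GC c L) {ε : ℝ} (hε : 0 < ε)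
    (μ ν : Measure (Euc d)) [IsProbabilityMeasure μ]
    (Q : Euc d → Euc d) (hQ : Measurable Q) {r : ℝ} (hQr : ∀ y, dist (Q y) y ≤ r)
    (π : Measure (Euc d × Euc d)) (hπ : IsCoupling π μ ν) :
    ∃ π', IsCoupling π' μ (ν.map Q) ∧ ∫⁻ p, KK (fun z => c z + ε * hh z) p ∂π' ≤
      ∫⁻ p, KK (fun z => c z + ε * hh z) p ∂π + ENNReal.ofReal ((L + ε) * r) := by
  have := coupling_prob hπ
  have hm : Measurable (fun p : Euc d × Euc d => (p.1, Q p.2)) := by fun_prop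
  refine ⟨π.map (fun p => (p.1, Q p.2)), ⟨?_, ?_⟩, ?_⟩
  · rw [Measure.map_map measurable_fst hm]; exact hπ.1
  · rw [Measure.map_map measurable_snd hm, ← hπ.2, Measure.map_map hQ measurable_snd]; rfl
  · rw [lintegral_map (KK_meas (GCe_cont hc ε)) hm]
    calc _ ≤ ∫⁻ p, (KK (fun z => c z + ε * hh z) p + ENNReal.ofReal ((L + ε) * r)) ∂π := by
          refine lintegral_mono fun p => ?_
          have hr : 0 ≤ r := dist_nonneg.trans (hQr 0)
          have hL := hc.Lpos
          simp only [KK]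
          rw [← ENNReal.ofReal_add (GCe_nonneg hc hε _) (by positivity)]
          refine ENNReal.ofReal_le_ofReal ?_
          have e : Q p.2 - p.1 = (p.2 - p.1) + (Q p.2 - p.2) := by abel
          have h1 := hc.add (p.2 - p.1) (Q p.2 - p.2)
          have h2 := hc.up (Q p.2 - p.2)
          have h3 := hh_lip (Q p.2 - p.1) (p.2 - p.1)
          have h4 : p.2 - p.1 - (Q p.2 - p.1) = p.2 - Q p.2 := by abel
          have h5 := hQr p.2
          rw [dist_eq_norm] at h5
          rw [h4, norm_sub_rev] at h3
          rw [← e] at h1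
          have h6 : L * ‖Q p.2 - p.2‖ ≤ L * r := by gcongr
          have h7 : ε * hh (Q p.2 - p.1) ≤ ε * (hh (p.2 - p.1) + r) := by gcongr; linarith
          linarith
      _ = _ := by
          rw [lintegral_add_right _ measurable_const]; simp

open Filter Topology in
lemma exists_eps {d : ℕ} {c : Euc d → ℝ} {L : ℝ} (hc : GC c L) {ε : ℝ} (hε : 0 < ε)
    (μ ν : Measure (Euc d)) [IsProbabilityMeasure μ] [IsProbabilityMeasure ν] (hac : μ ≪ volume)
    (hfin : ∃ π₀, IsCoupling π₀ μ ν ∧ ∫⁻ p, KK (fun z => c z + ε * hh z) p ∂π₀ ≠ ⊤) :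
    ∃ π, IsCoupling π μ ν ∧ ACP μ π ∧ ∀ π', IsCoupling π' μ ν →
      ∫⁻ p, KK (fun z => c z + ε * hh z) p ∂π ≤ ∫⁻ p, KK (fun z => c z + ε * hh z) p ∂π' := by
  obtain ⟨π₀, h₀, hf₀⟩ := hfin
  have hg := GCe_cont hc ε
  have hg0 := GCe_nonneg hc hε
  obtain ⟨m, hm, hmin⟩ := exists_min hg hg0 μ ν
  have hmf : ∫⁻ p, KK (fun z => c z + ε * hh z) p ∂m ≠ ⊤ :=
    ((hmin _ h₀).trans_lt hf₀.lt_top).ne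
  have hr : ∀ n : ℕ, 0 < 1 / ((n : ℝ) + 1) := fun n => by positivity
  choose Q hQ hQc hQr using fun n : ℕ => exists_round (d := d) (hr n)
  have hP : ∀ n, IsProbabilityMeasure (ν.map (Q n)) := fun n =>
    Measure.isProbabilityMeasure_map (hQ n).aemeasurable
  choose π hπ hπm using fun n : ℕ => exists_min hg hg0 μ (ν.map (Q n))
  set v : ℕ → ℝ≥0∞ := fun n => ∫⁻ p, KK (fun z => c z + ε * hh z) p ∂m +
    ENNReal.ofReal ((L + ε) * (1 / ((n : ℝ) + 1))) with hv
  have hπv : ∀ n, ∫⁻ p, KK (fun z => c z + ε * hh z) p ∂(π n) ≤ v n := by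
    intro n
    obtain ⟨π', h1, h2⟩ := round_coupling hc hε μ ν (Q n) (hQ n) (hQr n) m hm
    exact (hπm n _ h1).trans h2
  have hACP : ∀ n, ACP μ (π n) := by
    intro n
    refine AC_discrete hc hε μ _ hac (π n) (hπ n) (hπm n) ?_ (range (Q n)) (hQc n) ?_
    · refine ((hπv n).trans_lt ?_).ne
      simp only [hv]
      exact ENNReal.add_lt_top.2 ⟨hmf.lt_top, ENNReal.ofReal_lt_top⟩
    · rw [Measure.map_apply (hQ n) (hQc n).measurableSet.compl]
      convert measure_empty (μ := ν)
      ext y; simp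
  have ht : Tendsto (fun n : ℕ => 1 / ((n : ℝ) + 1)) atTop (𝓝 0) := tendsto_one_div_add_atTop_nhds_zero_nat
  obtain ⟨φ, π', hφ, hc', hG⟩ := exists_limit μ ν Q hQ (fun n => 1 / ((n : ℝ) + 1))
    (fun n => by rw [div_le_one (by positivity)]; linarith [n.cast_nonneg (α := ℝ)])
    ht hQr π hπ
  refine ⟨π', hc', AC_limit μ ν _ π' hG (fun n => (hπ _).1) (fun n => hACP _), fun π'' h'' => ?_⟩
  refine le_trans ?_ (hmin _ h'')
  refine KK_lsc hg hg0 _ π' hG (fun n => v (φ n)) _ (fun n => hπv _) ?_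
  refine Tendsto.comp (g := v) ?_ hφ.tendsto_atTop
  have h0 : Tendsto (fun n : ℕ => ENNReal.ofReal ((L + ε) * (1 / ((n : ℝ) + 1)))) atTop (𝓝 0) := by
    have := ENNReal.tendsto_ofReal (ht.const_mul (L + ε))
    simpa using this
  simpa [hv] using h0.const_add (∫⁻ p, KK (fun z => c z + ε * hh z) p ∂m)

lemma KK_split {d : ℕ} {c : Euc d → ℝ} {L : ℝ} (hc : GC c L) {ε : ℝ} (hε : 0 < ε)
    (π : Measure (Euc d × Euc d)) :
    ∫⁻ p, KK (fun z => c z + ε * hh z) p ∂π =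
      ∫⁻ p, KK c p ∂π + ENNReal.ofReal ε * ∫⁻ p, KK hh p ∂π := by
  rw [← lintegral_const_mul _ (KK_meas hh_cont), ← lintegral_add_left (KK_meas hc.cont)]
  refine lintegral_congr fun p => ?_
  simp only [KK]
  rw [ENNReal.ofReal_add (hc.nonneg _) (mul_nonneg hε.le (hh_pos _).le), ENNReal.ofReal_mul hε.le]

lemma KK_hh_fin {d : ℕ} {c : Euc d → ℝ} {L : ℝ} (hc : GC c L)
    (π : Measure (Euc d × Euc d)) [IsProbabilityMeasure π] (h : ∫⁻ p, KK c p ∂π ≠ ⊤) :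
    ∫⁻ p, KK hh p ∂π ≠ ⊤ := by
  have : ∫⁻ p, KK hh p ∂π ≤ ∫⁻ p, (1 + ENNReal.ofReal L * KK c p) ∂π := by
    refine lintegral_mono fun p => ?_
    simp only [KK]
    rw [← ENNReal.ofReal_mul hc.Lpos.le, ← ENNReal.ofReal_one,
      ← ENNReal.ofReal_add zero_le_one (mul_nonneg hc.Lpos.le (hc.nonneg _))]
    exact ENNReal.ofReal_le_ofReal ((hh_le _).trans (by linarith [hc.low (p.2 - p.1)]))
  refine (this.trans_lt ?_).ne
  rw [lintegral_add_left measurable_const, lintegral_const_mul _ (KK_meas hc.cont)]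
  simp only [lintegral_const, measure_univ, mul_one]
  exact ENNReal.add_lt_top.2 ⟨ENNReal.one_lt_top, ENNReal.mul_lt_top ENNReal.ofReal_lt_top h.lt_top⟩

open Filter Topology in
lemma exists_good {d : ℕ} {c : Euc d → ℝ} {L : ℝ} (hc : GC c L)
    (μ ν : Measure (Euc d)) [IsProbabilityMeasure μ] [IsProbabilityMeasure ν] (hac : μ ≪ volume)
    (hfin : ∃ π₀, IsCoupling π₀ μ ν ∧ ∫⁻ p, KK c p ∂π₀ ≠ ⊤) :
    ∃ π, IsCoupling π μ ν ∧ ACP μ π ∧ ∫⁻ p, KK c p ∂π ≠ ⊤ ∧ ∫⁻ p, KK hh p ∂π ≠ ⊤ ∧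
      (∀ π', IsCoupling π' μ ν → ∫⁻ p, KK c p ∂π ≤ ∫⁻ p, KK c p ∂π') ∧
      (∀ π', IsCoupling π' μ ν → ∫⁻ p, KK c p ∂π' ≤ ∫⁻ p, KK c p ∂π →
        ∫⁻ p, KK hh p ∂π ≤ ∫⁻ p, KK hh p ∂π') := by
  obtain ⟨π₀, h₀, hf₀⟩ := hfin
  have hP₀ := coupling_prob h₀
  have hε : ∀ n : ℕ, 0 < 1 / ((n : ℝ) + 1) := fun n => by positivity
  choose π hπ hA hm using fun n : ℕ => exists_eps hc (hε n) μ ν hac ⟨π₀, h₀, by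
    rw [KK_split hc (hε n)]
    exact (ENNReal.add_lt_top.2 ⟨hf₀.lt_top, ENNReal.mul_lt_top ENNReal.ofReal_lt_top
      (KK_hh_fin hc π₀ hf₀).lt_top⟩).ne⟩
  simp only [fun n : ℕ => KK_split hc (hε n)] at hm
  obtain ⟨φ, π', hφ, hc', hG⟩ := exists_limit μ ν (fun _ => id) (fun _ => measurable_id) (fun _ => 0)
    (by simp) tendsto_const_nhds (by simp) π (by simpa using hπ)
  have ht : Tendsto (fun n : ℕ => ENNReal.ofReal (1 / ((n : ℝ) + 1))) atTop (𝓝 0) := by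
    simpa using ENNReal.tendsto_ofReal (tendsto_one_div_add_atTop_nhds_zero_nat (𝕜 := ℝ))
  have hP' := coupling_prob hc'
  have hopt : ∀ π'', IsCoupling π'' μ ν → ∫⁻ p, KK c p ∂π' ≤ ∫⁻ p, KK c p ∂π'' := by
    intro π'' h''
    by_cases hf : ∫⁻ p, KK c p ∂π'' = ⊤
    · rw [hf]; exact le_top
    have := coupling_prob h''
    have hhf := KK_hh_fin hc π'' hf
    set v : ℕ → ℝ≥0∞ := fun n => ∫⁻ p, KK c p ∂π'' + ENNReal.ofReal (1 / ((n : ℝ) + 1)) * ∫⁻ p, KK hh p ∂π''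
      with hv
    refine KK_lsc hc.cont hc.nonneg _ π' hG (fun n => v (φ n)) _
      (fun n => le_self_add.trans (hm (φ n) π'' h'')) (Tendsto.comp (g := v) ?_ hφ.tendsto_atTop)
    have := (ENNReal.Tendsto.mul_const (b := ∫⁻ p, KK hh p ∂π'') ht (Or.inr hhf)).const_add (∫⁻ p, KK c p ∂π'')
    simpa [hv] using this
  have hf' : ∫⁻ p, KK c p ∂π' ≠ ⊤ := ((hopt _ h₀).trans_lt hf₀.lt_top).ne
  refine ⟨π', hc', AC_limit μ ν _ π' hG (fun n => (hπ _).1) (fun n => hA _), hf', KK_hh_fin hc π' hf', hopt, ?_⟩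
  intro π'' h'' hle
  have hf'' : ∫⁻ p, KK c p ∂π'' ≠ ⊤ := (hle.trans_lt hf'.lt_top).ne
  refine KK_lsc hh_cont (fun z => (hh_pos z).le) _ π' hG (fun _ => ∫⁻ p, KK hh p ∂π'') _
    (fun n => ?_) tendsto_const_nhds
  have h1 := hm (φ n) π'' h''
  have h2 := hle.trans (hopt _ (hπ (φ n)))
  have h3 := (add_le_add_left h2 _).trans h1
  rw [ENNReal.add_le_add_iff_left hf''] at h3
  exact (ENNReal.mul_le_mul_iff_right (by simpa using (hε (φ n))) ENNReal.ofReal_ne_top).1 h3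

lemma CC_mono {d : ℕ} {t : ℝ} (h : t ≤ 1 / 2) : CC d t ≤ CC d (1 / 2) := by
  unfold CC
  refine ENNReal.ofReal_le_ofReal ?_
  rw [abs_of_nonneg (by apply inv_nonneg.2; apply pow_nonneg; linarith),
    abs_of_nonneg (by apply inv_nonneg.2; apply pow_nonneg; norm_num)]
  gcongr

open Filter Topology in
lemma density_step {d : ℕ} (μ : Measure (Euc d))
    (π : Measure (Euc d × Euc d)) [IsFiniteMeasure π] (hA : ACP μ π) (M : NNReal)
    (A B : Set (Euc d)) (hAm : MeasurableSet A) (hB : MeasurableSet B) (hAM : A ⊆ GM μ M)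
    (hvol : volume A ≠ ⊤)
    (hne : π (A ×ˢ B) ≠ 0) {t₀ : ℝ} (ht₀ : 0 < t₀) :
    ∃ t, 0 < t ∧ t < t₀ ∧ t < 1 ∧ π (A ×ˢ B ∩ SS t ⁻¹' A) ≠ 0 := by
  by_contra! hcon
  set δ := π (A ×ˢ B) with hδ
  have hδt : δ ≠ ⊤ := measure_ne_top _ _
  set C : ℝ≥0∞ := M * CC d (1 / 2) with hC
  have hCt : C ≠ ⊤ := ENNReal.mul_ne_top (by simp) (by simp [CC])
  obtain ⟨V, hAV, hV, -, hVA⟩ := hAm.exists_isOpen_sdiff_lt hvol (ε := δ / 2 / (C + 1))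
    (ENNReal.div_pos (ENNReal.half_pos hne).ne' (by simp [hCt])).ne'
  set t : ℕ → ℝ := fun n => min t₀ (1 / 2) * (1 / ((n : ℝ) + 2)) with ht
  have hm0 : 0 < min t₀ (1 / 2) := lt_min ht₀ (by norm_num)
  have htpos : ∀ n, 0 < t n := fun n => by simp only [ht]; positivity
  have htlt : ∀ n, t n < min t₀ (1 / 2) := by
    intro n
    have : 1 / ((n : ℝ) + 2) < 1 := by
      rw [div_lt_one (by positivity)]; linarith [n.cast_nonneg (α := ℝ)]
    simp only [ht]; nlinarith
  have ht1 : Tendsto t atTop (𝓝 0) := by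
    have h1 : Tendsto (fun n : ℕ => 1 / ((n : ℝ) + 2)) atTop (𝓝 0) := by
      have := (tendsto_one_div_add_atTop_nhds_zero_nat (𝕜 := ℝ)).comp (tendsto_add_atTop_nat 1)
      refine this.congr fun n => ?_
      simp only [Function.comp]; push_cast; ring
    simpa [ht] using h1.const_mul (min t₀ (1 / 2))
  have hlim : Tendsto (fun n => (π.restrict (A ×ˢ B)) (SS (t n) ⁻¹' V)) atTop
      (𝓝 ((π.restrict (A ×ˢ B)) univ)) := by
    refine tendsto_measure_of_ae_tendsto_indicator_of_isFiniteMeasure atTop MeasurableSet.univ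
      (fun n => (SS_cont _).measurable hV.measurableSet) ?_
    filter_upwards [ae_restrict_mem (hAm.prod hB)] with p hp
    have h1 : Tendsto (fun n => SS (t n) p) atTop (𝓝 p.1) := by
      have : Continuous (fun s : ℝ => SS s p) := by unfold SS; fun_prop
      have h2 := (this.tendsto 0).comp ht1
      simpa [SS, Function.comp_def] using h2
    have h3 := h1 (hV.mem_nhds (hAV hp.1))
    filter_upwards [h3] with n hn
    simpa using hn
  rw [Measure.restrict_apply_univ, ← hδ] at hlim
  have hle : ∀ n, (π.restrict (A ×ˢ B)) (SS (t n) ⁻¹' V) ≤ δ / 2 := by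
    intro n
    have hn := lt_min_iff.1 (htlt n)
    have h0 := hcon (t n) (htpos n) hn.1 (hn.2.trans (by norm_num))
    rw [Measure.restrict_apply ((SS_cont _).measurable hV.measurableSet)]
    calc π (SS (t n) ⁻¹' V ∩ A ×ˢ B) ≤ π ((A ×ˢ B ∩ SS (t n) ⁻¹' A) ∪
            (Prod.fst ⁻¹' GM μ M ∩ SS (t n) ⁻¹' (V \ A))) := by
          refine measure_mono ?_
          rintro p ⟨hp, hp2⟩
          by_cases h : SS (t n) p ∈ A
          · exact Or.inl ⟨hp2, h⟩
          · exact Or.inr ⟨hAM hp2.1, hp, h⟩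
      _ ≤ π (A ×ˢ B ∩ SS (t n) ⁻¹' A) + π (Prod.fst ⁻¹' GM μ M ∩ SS (t n) ⁻¹' (V \ A)) :=
          measure_union_le _ _
      _ ≤ 0 + M * CC d (t n) * volume (V \ A) := by
          gcongr
          · exact h0.le
          · exact hA M (t n) (htpos n).le (hn.2.trans (by norm_num)) _ (hV.measurableSet.diff hAm)
      _ ≤ (C + 1) * (δ / 2 / (C + 1)) := by
          rw [zero_add]
          gcongr
          refine le_trans ?_ le_self_add
          rw [hC]; gcongr
          exact CC_mono hn.2.le
      _ = δ / 2 := ENNReal.mul_div_cancel (by simp) (by simp [hCt])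
  have := le_of_tendsto' hlim hle
  exact absurd this (not_le.2 (ENNReal.half_lt_self hne hδt))

open ProbabilityTheory in
lemma no_two {d : ℕ} {c : Euc d → ℝ} {L : ℝ} (hc : GC c L)
    (μ ν : Measure (Euc d)) [IsProbabilityMeasure μ] (hac : μ ≪ volume)
    (π : Measure (Euc d × Euc d)) [IsFiniteMeasure π] (hπ : IsCoupling π μ ν) (hA : ACP μ π)
    (hfc : ∫⁻ p, KK c p ∂π ≠ ⊤) (hfh : ∫⁻ p, KK hh p ∂π ≠ ⊤)
    (hlex : ∀ π', IsCoupling π' μ ν → ∫⁻ p, KK c p ∂π' ≤ ∫⁻ p, KK c p ∂π →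
        ∫⁻ p, KK hh p ∂π ≤ ∫⁻ p, KK hh p ∂π')
    (U B0 B1 : Set (Euc d)) (hU : MeasurableSet U) (hB0 : MeasurableSet B0) (hB1 : MeasurableSet B1)
    {t₀ : ℝ} (ht₀ : 0 < t₀)
    (hgood : ∀ x ∈ U, ∀ y ∈ B0, ∀ y' ∈ B1, ∀ t, 0 < t → t < t₀ →
      hh (y' - x) + hh (y - SS t (x, y)) < hh (y - x) + hh (y' - SS t (x, y))) :
    μ {x | x ∈ U ∧ π.condKernel x B0 ≠ 0 ∧ π.condKernel x B1 ≠ 0} = 0 := by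
  by_contra hN
  set N := {x | x ∈ U ∧ π.condKernel x B0 ≠ 0 ∧ π.condKernel x B1 ≠ 0} with hNdef
  have hfst : π.fst = μ := hπ.1
  have hdis : ∀ S B, MeasurableSet S → MeasurableSet B →
      π (S ×ˢ B) = ∫⁻ x in S, π.condKernel x B ∂μ := by
    intro S B hS hB
    conv_lhs => rw [← π.disintegrate π.condKernel]
    rw [Measure.compProd_apply_prod hS hB, hfst]
  have hKm : ∀ B, MeasurableSet B → Measurable (fun x => π.condKernel x B) := fun B hB =>
    Kernel.measurable_coe _ hB
  have hNm : MeasurableSet N := by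
    refine hU.inter (MeasurableSet.inter ?_ ?_)
    · exact (hKm B0 hB0) (measurableSet_singleton 0).compl
    · exact (hKm B1 hB1) (measurableSet_singleton 0).compl
  set f := μ.rnDeriv volume with hf
  have hfm : Measurable f := Measure.measurable_rnDeriv _ _
  have hfpos : ∀ᵐ x ∂μ, 0 < f x := Measure.rnDeriv_pos hac
  have hflt : ∀ᵐ x ∂μ, f x < ⊤ := hac.ae_le (Measure.rnDeriv_lt_top μ volume)
  -- choice of the set
  obtain ⟨n, hn⟩ : ∃ n : ℕ, μ (N ∩ {x | 0 < f x} ∩ GM μ n ∩ Metric.ball 0 n) ≠ 0 := by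
    by_contra! hcon
    have h1 := measure_iUnion_null hcon
    refine hN (measure_mono_null_ae ?_ h1)
    filter_upwards [hfpos, hflt] with x hx1 hx2 hxN
    obtain ⟨n1, hn1⟩ := ENNReal.exists_nat_gt hx2.ne
    obtain ⟨n2, hn2⟩ := exists_nat_gt ‖x‖
    refine mem_iUnion.2 ⟨max n1 n2, ⟨⟨hxN, hx1⟩, ?_⟩, ?_⟩
    · simp only [GM, mem_ofPred_eq]
      refine hn1.le.trans ?_
      simp
    · rw [mem_ball_zero_iff]
      exact hn2.trans_le (by simp)
  set A := N ∩ {x | 0 < f x} ∩ GM μ n ∩ Metric.ball 0 n with hAdef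
  have hAm : MeasurableSet A :=
    ((hNm.inter (measurableSet_lt measurable_const hfm)).inter (GM_meas _ _)).inter measurableSet_ball
  have hAN : A ⊆ N := fun x hx => hx.1.1.1
  have hAf : ∀ x ∈ A, 0 < f x := fun x hx => hx.1.1.2
  have hAM : A ⊆ GM μ n := fun x hx => hx.1.2
  have hvol : volume A ≠ ⊤ :=
    ((measure_mono (fun x hx => hx.2 : A ⊆ Metric.ball 0 n)).trans_lt measure_ball_lt_top).ne
  have hnull : ∀ S ⊆ A, MeasurableSet S → ∀ B, MeasurableSet B → (∀ x ∈ A, π.condKernel x B ≠ 0) →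
      π (S ×ˢ B) = 0 → μ S = 0 := by
    intro S hSA hS B hB hAB h0
    rw [hdis S B hS hB, lintegral_eq_zero_iff (hKm B hB)] at h0
    by_contra hne
    have h2 : ∀ᵐ x ∂(μ.restrict S), False := by
      filter_upwards [h0, ae_restrict_mem hS] with x hx hxS
      exact hAB x (hSA hxS) hx
    rw [Filter.eventually_false_iff_eq_bot, ae_eq_bot, Measure.restrict_eq_zero] at h2
    exact hne h2
  have hne0 : π (A ×ˢ B0) ≠ 0 := fun h =>
    hn (hnull A subset_rfl hAm B0 hB0 (fun x hx => (hAN hx).2.1) h)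
  obtain ⟨t, ht0, htt, ht1, hta⟩ := density_step μ π hA n A B0 hAm hB0 hAM hvol hne0 ht₀
  have hSm : Measurable (SS t : Euc d × Euc d → Euc d) := (SS_cont t).measurable
  have hns : ¬ ((π.restrict (A ×ˢ B0)).map (SS t) ⟂ₘ (π.restrict (A ×ˢ B1)).map Prod.fst) := by
    rintro ⟨s, hs, h1, h2⟩
    rw [Measure.map_apply hSm hs, Measure.restrict_apply (hSm hs)] at h1
    rw [Measure.map_apply measurable_fst hs.compl, Measure.restrict_apply (measurable_fst hs.compl)] at h2
    have e : Prod.fst ⁻¹' sᶜ ∩ A ×ˢ B1 = (A ∩ sᶜ) ×ˢ B1 := by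
      ext p; simp only [mem_inter_iff, mem_preimage, mem_prod]; tauto
    rw [e] at h2
    have h3 : μ (A ∩ sᶜ) = 0 := hnull _ inter_subset_left (hAm.inter hs.compl) B1 hB1
      (fun x hx => (hAN hx).2.2) h2
    have h4 : volume (A ∩ sᶜ) = 0 := by
      rw [← Measure.withDensity_rnDeriv_eq μ volume hac, withDensity_apply_eq_zero hfm] at h3
      refine measure_mono_null ?_ h3
      intro x hx
      exact ⟨(hAf x hx.1).ne', hx⟩
    have h5 := hA n t ht0.le ht1 (A ∩ sᶜ) (hAm.inter hs.compl)
    rw [h4, mul_zero] at h5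
    refine hta (measure_mono_null ?_ (measure_union_null h1 (nonpos_iff_eq_zero.1 h5)))
    rintro p ⟨hp, hp2⟩
    by_cases h : SS t p ∈ s
    · exact Or.inl ⟨h, hp⟩
    · exact Or.inr ⟨hAM hp.1, hp2, h⟩
  obtain ⟨κ, hκ0, hκ1, hκ2, hκ3⟩ := glue _ _ _ _ hSm measurable_fst hns
  have m1 : ∀ᵐ z ∂κ, z.1 ∈ A ×ˢ B0 := by
    refine ae_of_ae_map measurable_fst.aemeasurable (p := fun p => p ∈ A ×ˢ B0) ?_
    exact (Measure.absolutelyContinuous_of_le hκ1).ae_le (ae_restrict_mem (hAm.prod hB0))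
  have m2 : ∀ᵐ z ∂κ, z.2 ∈ A ×ˢ B1 := by
    refine ae_of_ae_map measurable_snd.aemeasurable (p := fun p => p ∈ A ×ˢ B1) ?_
    exact (Measure.absolutelyContinuous_of_le hκ2).ae_le (ae_restrict_mem (hAm.prod hB1))
  obtain ⟨π', p1, p2, p3⟩ := swap_cost π κ hκ0 (hκ1.trans Measure.restrict_le_self)
    (hκ2.trans Measure.restrict_le_self)
  have hc' := (p3 (KK c) (KK_meas hc.cont) hfc).1 (by
    filter_upwards [hκ3] with z hz
    obtain ⟨⟨x, y⟩, ⟨x', y'⟩⟩ := z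
    simp only at hz
    simp only [KK]
    refine ofReal_add_le4 (hc.nonneg _) (hc.nonneg _) (hc.nonneg _) (hc.nonneg _) ?_
    have e1 : x' - x = t • (y - x) := by rw [← hz]; simp only [SS]; module
    have e2 : y - x' = (1 - t) • (y - x) := by rw [← hz]; simp only [SS]; module
    have h1 := hc.add (x' - x) (y' - x')
    have e3 : x' - x + (y' - x') = y' - x := by abel
    rw [e3, e1, hc.smul t ht0.le] at h1
    rw [e2, hc.smul (1 - t) (by linarith)]
    linarith)
  have hh' := (p3 (KK hh) (KK_meas hh_cont) hfh).2 (by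
    filter_upwards [hκ3, m1, m2] with z hz hz1 hz2
    obtain ⟨⟨x, y⟩, ⟨x', y'⟩⟩ := z
    simp only at hz
    simp only [KK]
    refine ofReal_add_lt4 (hh_pos _).le (hh_pos _).le (hh_pos _).le (hh_pos _).le ?_
    rw [← hz]
    exact hgood x (hAN hz1.1).1 y hz1.2 y' hz2.2 t ht0 htt)
  exact absurd (hlex π' ⟨p1.trans hπ.1, p2.trans hπ.2⟩ hc') (not_le.2 hh')

open Filter Topology in
lemma good_nhds {d : ℕ} {x y y' : Euc d} (h : gg (y' - x) (y - x) < gg (y - x) (y - x)) :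
    ∃ U B0 B1 : Set (Euc d), U ∈ TopologicalSpace.countableBasis (Euc d) ∧
      B0 ∈ TopologicalSpace.countableBasis (Euc d) ∧ B1 ∈ TopologicalSpace.countableBasis (Euc d) ∧
      ∃ k : ℕ, x ∈ U ∧ y ∈ B0 ∧ y' ∈ B1 ∧ ∀ x ∈ U, ∀ y ∈ B0, ∀ y' ∈ B1, ∀ t : ℝ, 0 < t → t < 1 / ((k : ℝ) + 1) →
      hh (y' - x) + hh (y - SS t (x, y)) < hh (y - x) + hh (y' - SS t (x, y)) := by
  have hcont : Continuous (fun q : ((Euc d × Euc d) × Euc d) × ℝ =>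
      gg ((1 - q.2) • (q.1.1.2 - q.1.1.1)) (q.1.1.2 - q.1.1.1) -
        gg (q.1.2 - q.1.1.1) (q.1.1.2 - q.1.1.1)) := by
    refine Continuous.sub ?_ ?_
    · exact gg_cont.comp (f := fun q : ((Euc d × Euc d) × Euc d) × ℝ =>
        ((1 - q.2) • (q.1.1.2 - q.1.1.1), (q.1.1.2 - q.1.1.1))) (by fun_prop)
    · exact gg_cont.comp (f := fun q : ((Euc d × Euc d) × Euc d) × ℝ =>
        ((q.1.2 - q.1.1.1), (q.1.1.2 - q.1.1.1))) (by fun_prop)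
  have hev : ∀ᶠ q in 𝓝 ((((x, y), y'), (0 : ℝ)) : ((Euc d × Euc d) × Euc d) × ℝ),
      0 < gg ((1 - q.2) • (q.1.1.2 - q.1.1.1)) (q.1.1.2 - q.1.1.1) -
        gg (q.1.2 - q.1.1.1) (q.1.1.2 - q.1.1.1) := by
    refine hcont.continuousAt.eventually (lt_mem_nhds ?_)
    simpa using h
  rw [nhds_prod_eq, nhds_prod_eq, nhds_prod_eq] at hev
  obtain ⟨W, hW, T, hT, hWT⟩ := Filter.mem_prod_iff.1 hev
  obtain ⟨W', hW', V1, hV1, hW2⟩ := Filter.mem_prod_iff.1 hW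
  obtain ⟨V, hV, V0, hV0, hW3⟩ := Filter.mem_prod_iff.1 hW'
  have hb := TopologicalSpace.isBasis_countableBasis (Euc d)
  obtain ⟨U, hU, hxU, hUV⟩ := hb.mem_nhds_iff.1 hV
  obtain ⟨B0, hB0, hyB, hBV0⟩ := hb.mem_nhds_iff.1 hV0
  obtain ⟨B1, hB1, hyB1, hBV1⟩ := hb.mem_nhds_iff.1 hV1
  obtain ⟨δ, hδ, hδT⟩ := Metric.mem_nhds_iff.1 hT
  obtain ⟨k, hk⟩ := exists_nat_one_div_lt hδ
  refine ⟨U, B0, B1, hU, hB0, hB1, k, hxU, hyB, hyB1, ?_⟩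
  intro x hx y hy y' hy' t ht htk
  have hq : (((x, y), y'), t) ∈ W ×ˢ T := by
    refine ⟨hW2 ⟨hW3 ⟨hUV hx, hBV0 hy⟩, hBV1 hy'⟩, hδT ?_⟩
    rw [Metric.mem_ball, dist_zero_right, Real.norm_eq_abs, abs_of_pos ht]
    linarith
  have := hWT hq
  simp only [mem_ofPred_eq, sub_pos] at this
  have h2 := hh_gap ht this
  have e1 : y - SS t (x, y) = (1 - t) • (y - x) := by simp only [SS]; module
  have e2 : y' - SS t (x, y) = (y' - x) - t • (y - x) := by simp only [SS]; module
  rw [e1, e2]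
  exact h2

open Filter Topology in
lemma dirac_of_sep {d : ℕ} (ρ : Measure (Euc d)) [IsProbabilityMeasure ρ]
    (h : ∀ y y' : Euc d, y ≠ y' → ∃ B0 ∈ 𝓝 y, ∃ B1 ∈ 𝓝 y', ρ B0 = 0 ∨ ρ B1 = 0) :
    ∃ y, ρ = Measure.dirac y := by
  obtain ⟨y, -, hy⟩ := exists_mem_forall_mem_nhdsWithin_pos_measure (μ := ρ) (s := univ) (by simp)
  have hnull : ρ {y}ᶜ = 0 := by
    by_contra hne
    obtain ⟨y', hy', hy2⟩ := exists_mem_forall_mem_nhdsWithin_pos_measure hne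
    obtain ⟨B0, hB0, B1, hB1, h0 | h0⟩ := h y y' (fun e => hy' (by simp [e]))
    · exact (hy B0 (mem_nhdsWithin_of_mem_nhds hB0)).ne' h0
    · exact (hy2 B1 (mem_nhdsWithin_of_mem_nhds hB1)).ne' h0
  refine ⟨y, ?_⟩
  have hae : (id : Euc d → Euc d) =ᵐ[ρ] fun _ => y := by
    rw [Filter.EventuallyEq, ae_iff]; exact hnull
  have : ρ.map id = ρ.map (fun _ => y) := Measure.map_congr hae
  rw [Measure.map_id, Measure.map_const] at this
  simpa using this

open Filter Topology ProbabilityTheory in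
lemma exists_map {d : ℕ} {c : Euc d → ℝ} {L : ℝ} (hc : GC c L)
    (μ ν : Measure (Euc d)) [IsProbabilityMeasure μ] (hac : μ ≪ volume)
    (π : Measure (Euc d × Euc d)) [IsFiniteMeasure π] (hπ : IsCoupling π μ ν) (hA : ACP μ π)
    (hfc : ∫⁻ p, KK c p ∂π ≠ ⊤) (hfh : ∫⁻ p, KK hh p ∂π ≠ ⊤)
    (hlex : ∀ π', IsCoupling π' μ ν → ∫⁻ p, KK c p ∂π' ≤ ∫⁻ p, KK c p ∂π →
        ∫⁻ p, KK hh p ∂π ≤ ∫⁻ p, KK hh p ∂π') :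
    ∃ T : Euc d → Euc d, Measurable T ∧ π = μ.map (fun x => (x, T x)) := by
  have hfst : π.fst = μ := hπ.1
  set bs := TopologicalSpace.countableBasis (Euc d) with hbs
  have hbo : ∀ U ∈ bs, IsOpen U := fun U hU => TopologicalSpace.isOpen_of_mem_countableBasis hU
  have hcnt : bs.Countable := TopologicalSpace.countable_countableBasis _
  have hae : ∀ᵐ x ∂μ, ∀ U ∈ bs, ∀ B0 ∈ bs, ∀ B1 ∈ bs, ∀ k : ℕ,
      (∀ x ∈ U, ∀ y ∈ B0, ∀ y' ∈ B1, ∀ t : ℝ, 0 < t → t < 1 / ((k : ℝ) + 1) →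
        hh (y' - x) + hh (y - SS t (x, y)) < hh (y - x) + hh (y' - SS t (x, y))) →
      ¬ (x ∈ U ∧ π.condKernel x B0 ≠ 0 ∧ π.condKernel x B1 ≠ 0) := by
    rw [ae_ball_iff hcnt]; intro U hU
    rw [ae_ball_iff hcnt]; intro B0 hB0
    rw [ae_ball_iff hcnt]; intro B1 hB1
    rw [ae_all_iff]; intro k
    by_cases hg : (∀ x ∈ U, ∀ y ∈ B0, ∀ y' ∈ B1, ∀ t : ℝ, 0 < t → t < 1 / ((k : ℝ) + 1) →
        hh (y' - x) + hh (y - SS t (x, y)) < hh (y - x) + hh (y' - SS t (x, y)))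
    · have := no_two hc μ ν hac π hπ hA hfc hfh hlex U B0 B1 (hbo U hU).measurableSet
        (hbo B0 hB0).measurableSet (hbo B1 hB1).measurableSet (by positivity) hg
      rw [← compl_compl {x | x ∈ U ∧ _}] at this
      filter_upwards [mem_ae_iff.2 this] with x hx _
      exact hx
    · exact Eventually.of_forall fun x hx => absurd hx hg
  have hdir : ∀ᵐ x ∂μ, ∃ y, π.condKernel x = Measure.dirac y := by
    filter_upwards [hae] with x hx
    refine dirac_of_sep _ fun y y' hyy => ?_
    have hne : y - x ≠ y' - x := fun e => hyy (sub_left_injective e)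
    rcases gg_mono hne with hg | hg
    · obtain ⟨U, B0, B1, hU, hB0, hB1, k, hxU, hy0, hy1, H⟩ := good_nhds hg
      have h := hx U hU B0 hB0 B1 hB1 k H
      refine ⟨B0, (hbo _ hB0).mem_nhds hy0, B1, (hbo _ hB1).mem_nhds hy1, ?_⟩
      by_contra! hcon
      exact h ⟨hxU, hcon⟩
    · obtain ⟨U, B0, B1, hU, hB0, hB1, k, hxU, hy0, hy1, H⟩ := good_nhds hg
      have h := hx U hU B0 hB0 B1 hB1 k H
      refine ⟨B1, (hbo _ hB1).mem_nhds hy1, B0, (hbo _ hB0).mem_nhds hy0, ?_⟩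
      by_contra! hcon
      exact h ⟨hxU, hcon.2, hcon.1⟩
  have hTm : Measurable (fun x => ∫ y, y ∂(π.condKernel x)) :=
    (StronglyMeasurable.integral_kernel (κ := π.condKernel) stronglyMeasurable_id).measurable
  refine ⟨_, hTm, ?_⟩
  have hK : π.condKernel =ᵐ[μ] Kernel.deterministic _ hTm := by
    filter_upwards [hdir] with x ⟨y, hy⟩
    rw [Kernel.deterministic_apply, hy, integral_dirac]
  conv_lhs => rw [← π.disintegrate π.condKernel, hfst]
  rw [Measure.compProd_congr hK, Measure.compProd_deterministic]


/-- **Solution of the Monge problem for a general convex norm** (Theorem 1.8 of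
Bianchini–Daneri): if `μ ≪ L^d` and some coupling of `μ, ν` has finite `‖·‖_{D*}`-cost,
then there is an optimal transport map. -/
theorem statement_0 {d : ℕ} (D : Set (Euc d))
    (hDcp : IsCompact D) (hDcv : Convex ℝ D) (hD0 : (0 : Euc d) ∈ interior D)
    (μ ν : Measure (Euc d)) [IsProbabilityMeasure μ] [IsProbabilityMeasure ν]
    (hac : μ ≪ volume)
    (hfin : ∃ π₀ : Measure (Euc d × Euc d), IsCoupling π₀ μ ν ∧
      ∫⁻ p, normCost D p ∂π₀ ≠ ⊤) :
    ∃ T : Euc d → Euc d, Measurable T ∧ μ.map T = ν ∧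
      ∫⁻ x, ENNReal.ofReal (gauge D (T x - x)) ∂μ =
        ⨅ (π : Measure (Euc d × Euc d)) (_ : IsCoupling π μ ν), ∫⁻ p, normCost D p ∂π := by
  obtain ⟨L, hc⟩ := gauge_GC D hDcp hDcv hD0
  obtain ⟨π, hπ, hA, hfc, hfh, hopt, hlex⟩ := exists_good hc μ ν hac hfin
  have := coupling_prob hπ
  obtain ⟨T, hT, hπT⟩ := exists_map hc μ ν hac π hπ hA hfc hfh hlex
  have hm : Measurable (fun x => (x, T x)) := measurable_id.prodMk hT
  refine ⟨T, hT, ?_, ?_⟩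
  · rw [← hπ.2, hπT, Measure.map_map measurable_snd hm]; rfl
  · have e : ∫⁻ x, ENNReal.ofReal (gauge D (T x - x)) ∂μ = ∫⁻ p, KK (gauge D) p ∂π := by
      rw [hπT, lintegral_map (KK_meas hc.cont) hm]; rfl
    rw [e]
    refine le_antisymm (le_iInf₂ fun π' h' => hopt π' h') ?_
    exact iInf₂_le π hπ
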